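/- arXiv:2311.05024 — 5 statements merged into one kernel-verified Lean document; each statement's English description precedes it below -/
import Mathlib

section
/- Let n be a finite index type, M : Matrix n n ℝ such that 1 - M is invertible, and e : n → ℝ. Set d := (1 - M) *ᵥ e. Then for every polynomial p ∈ ℝ[X], (Polynomial.aeval M p) *ᵥ d = 0 if and only if (Polynomial.aeval M p) *ᵥ e = 0. Consequently the minimal polynomial of M with respect to e and the minimal polynomial of M with respect to d coincide. -/
open Matrix Polynomial

/-- If `1 - M` is invertible and `d = (1 - M) *ᵥ e`, then a polynomial annihilates
`d` under `M` iff it annihilates `e`; consequently the minimal polynomials of `M`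
with respect to `e` and to `d` coincide. -/
theorem minimal_polynomial_error_eq_difference
    {n : Type*} [Fintype n] [DecidableEq n]
    (M : Matrix n n ℝ) (hM : IsUnit (1 - M)) (e : n → ℝ)
    (d : n → ℝ) (hd : d = (1 - M) *ᵥ e) :
    (∀ p : ℝ[X], (Polynomial.aeval M p) *ᵥ d = 0 ↔ (Polynomial.aeval M p) *ᵥ e = 0) ∧
    (∀ p : ℝ[X],
      (p.Monic ∧ (Polynomial.aeval M p) *ᵥ e = 0 ∧
        ∀ q : ℝ[X], q.Monic → (Polynomial.aeval M q) *ᵥ e = 0 → p.degree ≤ q.degree) ↔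
      (p.Monic ∧ (Polynomial.aeval M p) *ᵥ d = 0 ∧
        ∀ q : ℝ[X], q.Monic → (Polynomial.aeval M q) *ᵥ d = 0 → p.degree ≤ q.degree)) := by
  have key : ∀ p : ℝ[X],
      (Polynomial.aeval M p) *ᵥ d = 0 ↔ (Polynomial.aeval M p) *ᵥ e = 0 := by
    intro p
    have hc : Polynomial.aeval M p * (1 - M) = (1 - M) * Polynomial.aeval M p := by
      have h1 : (1 - M) = Polynomial.aeval M (1 - X : ℝ[X]) := by simp
      rw [h1, ← map_mul, ← map_mul, mul_comm]
    rw [hd, Matrix.mulVec_mulVec, hc, ← Matrix.mulVec_mulVec]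
    constructor
    · intro h
      exact Matrix.mulVec_injective_of_isUnit hM (by rw [h, Matrix.mulVec_zero])
    · intro h
      rw [h, Matrix.mulVec_zero]
  refine ⟨key, fun p => ?_⟩
  simp only [key]
end

section
/- Let n be a finite index type, M : Matrix n n ℝ with 1 - M invertible, and x : n → ℝ. Suppose p ∈ ℝ[X] is monic, (Polynomial.aeval M p) *ᵥ x = 0, and every monic q ∈ ℝ[X] with (Polynomial.aeval M q) *ᵥ x = 0 satisfies p.degree ≤ q.degree (i.e. p is the minimal polynomial of M with respect to x). Then p.eval 1 ≠ 0. -/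
open Matrix Polynomial

/-- If `1 - M` is invertible (i.e. 1 is not an eigenvalue of `M`), then the minimal
polynomial `p` of `M` with respect to `x` satisfies `p.eval 1 ≠ 0`, i.e. the sum of
its coefficients is nonzero. -/
theorem minimal_polynomial_eval_one_ne_zero
    {n : Type*} [Fintype n] [DecidableEq n]
    (M : Matrix n n ℝ) (hM : IsUnit (1 - M)) (x : n → ℝ)
    (p : ℝ[X]) (hp : p.Monic) (hann : (Polynomial.aeval M p) *ᵥ x = 0)
    (hmin : ∀ q : ℝ[X], q.Monic → (Polynomial.aeval M q) *ᵥ x = 0 →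
      p.degree ≤ q.degree) :
    p.eval 1 ≠ 0 := by
  intro h
  obtain ⟨q, rfl⟩ := Polynomial.dvd_iff_isRoot.mpr h
  have hX : (X - C (1 : ℝ)).Monic := monic_X_sub_C 1
  have hq : q.Monic := hX.of_mul_monic_left hp
  have hM' : IsUnit (M - 1) := by
    have := hM.neg
    rwa [neg_sub] at this
  have h0 : (Polynomial.aeval M q) *ᵥ x = 0 := by
    obtain ⟨u, hu⟩ := hM'
    have h1 : (M - 1) *ᵥ ((Polynomial.aeval M q) *ᵥ x) = 0 := by
      rw [Matrix.mulVec_mulVec, ← hann]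
      simp
    have h2 : ((↑u⁻¹ : Matrix n n ℝ) * (M - 1)) *ᵥ ((Polynomial.aeval M q) *ᵥ x) = 0 := by
      rw [← Matrix.mulVec_mulVec, h1, Matrix.mulVec_zero]
    rwa [← hu, Units.inv_mul, Matrix.one_mulVec] at h2
  have hd := Polynomial.natDegree_le_natDegree (hmin q hq h0)
  rw [hX.natDegree_mul hq, natDegree_X_sub_C] at hd
  omega
end

section
/- Let n be a finite index type, M : Matrix n n ℝ, B : n → ℝ, and let X : ℕ → (n → ℝ) satisfy X (k+1) = M *ᵥ X k + B for all k. Assume 1 - M is invertible and let X̄ : n → ℝ satisfy X̄ = M *ᵥ X̄ + B. Fix k : ℕ, set D j := X (j+1) - X j, and suppose p ∈ ℝ[X] is monic of natural degree d with coefficients θ_i (so θ_d = 1), that (Polynomial.aeval M p) *ᵥ (D k) = 0, and that every monic q with (Polynomial.aeval M q) *ᵥ (D k) = 0 has p.degree ≤ q.degree. Then Σ_{i=0}^{d} θ_i ≠ 0 and X̄ = (Σ_{i=0}^{d} θ_i • X (k+i)) / (Σ_{i=0}^{d} θ_i). -/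
open Matrix Polynomial Finset

/-- Determination of the limit (fixed point) of a linear iterative process via the
minimal polynomial of `M` with respect to the forward difference `D k`:
`Σ θᵢ ≠ 0` and `X̄ = (Σ θᵢ X (k+i)) / (Σ θᵢ)`. -/
theorem limit_via_minimal_polynomial
    {n : Type*} [Fintype n] [DecidableEq n]
    (M : Matrix n n ℝ) (B : n → ℝ) (X : ℕ → n → ℝ)
    (hX : ∀ k, X (k + 1) = M *ᵥ X k + B)
    (hM : IsUnit (1 - M))
    (Xbar : n → ℝ) (hXbar : Xbar = M *ᵥ Xbar + B)
    (k : ℕ) (D : ℕ → n → ℝ) (hD : ∀ j, D j = X (j + 1) - X j)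
    (p : ℝ[X]) (d : ℕ) (hp : p.Monic) (hdeg : p.natDegree = d)
    (hann : (Polynomial.aeval M p) *ᵥ (D k) = 0)
    (hmin : ∀ q : ℝ[X], q.Monic → (Polynomial.aeval M q) *ᵥ (D k) = 0 →
      p.degree ≤ q.degree) :
    (∑ i ∈ Finset.range (d + 1), p.coeff i) ≠ 0 ∧
    Xbar = (∑ i ∈ Finset.range (d + 1), p.coeff i)⁻¹ •
      ∑ i ∈ Finset.range (d + 1), p.coeff i • X (k + i) := by
  have hinj : ∀ v : n → ℝ, (1 - M) *ᵥ v = 0 → v = 0 := by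
    intro v hv
    exact (Matrix.mulVec_injective_iff_isUnit.mpr hM) (by rw [hv, Matrix.mulVec_zero])
  have hsum : (∑ i ∈ Finset.range (d + 1), p.coeff i) = p.eval 1 := by
    rw [Polynomial.eval_eq_sum_range, hdeg]
    simp
  have hne : p.eval 1 ≠ 0 := by
    intro h0
    obtain ⟨q, hq⟩ := Polynomial.dvd_iff_isRoot.mpr h0
    have hqm : q.Monic := (Polynomial.monic_X_sub_C (1 : ℝ)).of_mul_monic_left (hq ▸ hp)
    have h1 : (Polynomial.aeval M q) *ᵥ (D k) = 0 := by
      apply hinj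
      have h2 := hann
      rw [hq] at h2
      simp only [map_mul, map_sub, Polynomial.aeval_X, map_one] at h2
      rw [← Matrix.mulVec_mulVec] at h2
      rw [← neg_sub M 1, Matrix.neg_mulVec, h2, neg_zero]
    have h3 := Polynomial.natDegree_le_natDegree (hmin q hqm h1)
    rw [hq, (Polynomial.monic_X_sub_C (1 : ℝ)).natDegree_mul hqm,
      Polynomial.natDegree_X_sub_C] at h3
    omega
  have hE : ∀ i, X (k + i) - Xbar = (M ^ i) *ᵥ (X k - Xbar) := by
    intro i
    induction i with
    | zero => simp
    | succ i ih =>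
      rw [pow_succ', ← Matrix.mulVec_mulVec, ← ih, ← add_assoc, hX, Matrix.mulVec_sub]
      nth_rewrite 1 [hXbar]
      abel
  have hDk : D k = -((1 - M) *ᵥ (X k - Xbar)) := by
    have h := hE 1
    rw [pow_one] at h
    rw [hD, Matrix.sub_mulVec, ← h, Matrix.one_mulVec]
    abel
  have hcomm : (1 - M) * Polynomial.aeval M p = Polynomial.aeval M p * (1 - M) := by
    have h : (1 - M) = Polynomial.aeval M (1 - Polynomial.X : ℝ[X]) := by simp
    rw [h, ← map_mul, ← map_mul, mul_comm]
  have hz : (Polynomial.aeval M p) *ᵥ (X k - Xbar) = 0 := by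
    apply hinj
    rw [hDk, Matrix.mulVec_neg, neg_eq_zero, Matrix.mulVec_mulVec] at hann
    rw [Matrix.mulVec_mulVec, hcomm, hann]
  rw [Polynomial.aeval_eq_sum_range, hdeg, Matrix.sum_mulVec] at hz
  simp only [Matrix.smul_mulVec, ← hE, smul_sub, Finset.sum_sub_distrib] at hz
  rw [← Finset.sum_smul, hsum, sub_eq_zero] at hz
  rw [hsum]
  refine ⟨hne, ?_⟩
  rw [hz, smul_smul, inv_mul_cancel₀ hne, one_smul]
end

section
/- Let n be a finite index type, M : Matrix n n ℝ, and x : n → ℝ. Suppose p ∈ ℝ[X] is monic of natural degree d, (Polynomial.aeval M p) *ᵥ x = 0, and every monic q ∈ ℝ[X] with (Polynomial.aeval M q) *ᵥ x = 0 satisfies p.degree ≤ q.degree. Then there exists a unique θ : Fin d → ℝ such that Σ_{i=0}^{d-1} θ i • ((M ^ (i : ℕ)) *ᵥ x) = -((M ^ d) *ᵥ x). -/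
open Matrix Polynomial Finset

/-- If `p` is the minimal polynomial of `M` with respect to `x`, of degree `d`,
then the linear system `Σ_{i=0}^{d-1} θᵢ • (Mⁱ *ᵥ x) = -(M^d *ᵥ x)` is consistent
and has a unique solution. -/
theorem krylov_system_exists_unique_solution
    {n : Type*} [Fintype n] [DecidableEq n]
    (M : Matrix n n ℝ) (x : n → ℝ)
    (p : ℝ[X]) (d : ℕ) (hp : p.Monic) (hdeg : p.natDegree = d)
    (hann : (Polynomial.aeval M p) *ᵥ x = 0)
    (hmin : ∀ q : ℝ[X], q.Monic → (Polynomial.aeval M q) *ᵥ x = 0 →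
      p.degree ≤ q.degree) :
    ∃! θ : Fin d → ℝ,
      ∑ i : Fin d, θ i • ((M ^ (i : ℕ)) *ᵥ x) = -((M ^ d) *ᵥ x) := by
  have key : ∀ c : Fin d → ℝ,
      (Polynomial.aeval M (∑ i : Fin d, C (c i) * X ^ (i : ℕ))) *ᵥ x
        = ∑ i : Fin d, c i • ((M ^ (i : ℕ)) *ᵥ x) := by
    intro c
    rw [map_sum, Matrix.sum_mulVec]
    refine Finset.sum_congr rfl fun i _ => ?_
    rw [map_mul, aeval_C, map_pow, aeval_X, ← Algebra.smul_def, Matrix.smul_mulVec]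
  have inj : ∀ c : Fin d → ℝ, ∑ i : Fin d, c i • ((M ^ (i : ℕ)) *ᵥ x) = 0 → c = 0 := by
    intro c hc
    rw [← key] at hc
    set q : ℝ[X] := ∑ i : Fin d, C (c i) * X ^ (i : ℕ) with hq
    have hlt : q.degree < d := Polynomial.degree_sum_fin_lt c
    have hq0 : q = 0 := by
      by_contra hne
      have h1 := hmin (q * C q.leadingCoeff⁻¹) (monic_mul_leadingCoeff_inv hne) (by
        rw [mul_comm, map_mul, ← Matrix.mulVec_mulVec, hc, Matrix.mulVec_zero])
      rw [degree_mul_leadingCoeff_inv _ hne, degree_eq_natDegree hp.ne_zero, hdeg] at h1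
      exact absurd hlt (not_lt.mpr h1)
    funext i
    have h2 : q.coeff (i : ℕ) = c i := by
      rw [hq, finsetSum_coeff, Finset.sum_eq_single i]
      · simp
      · intro b _ hb
        have : (i : ℕ) ≠ b := fun h => hb (Fin.ext h.symm)
        simp [coeff_X_pow, this]
      · simp
    rw [← h2, hq0]; simp
  have ex : ∑ i : Fin d, p.coeff i • ((M ^ (i : ℕ)) *ᵥ x) = -((M ^ d) *ᵥ x) := by
    have h := hann
    rw [hp.as_sum, hdeg, map_add, Matrix.add_mulVec, ← Fin.sum_univ_eq_sum_range
      (fun i => C (p.coeff i) * X ^ i), key fun i => p.coeff i, map_pow, aeval_X] at h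
    exact eq_neg_of_add_eq_zero_right h
  refine ⟨fun i => p.coeff i, ex, fun θ hθ => ?_⟩
  have h := inj (θ - fun i : Fin d => p.coeff i) (by
    simp only [Pi.sub_apply, sub_smul, Finset.sum_sub_distrib]
    rw [hθ, ex, sub_self])
  exact sub_eq_zero.mp h
end

section
/- Let n be a finite index type, M : Matrix n n ℝ with 1 - M invertible, and x : n → ℝ. Suppose p ∈ ℝ[X] is monic of natural degree d, (Polynomial.aeval M p) *ᵥ x = 0, and every monic q ∈ ℝ[X] with (Polynomial.aeval M q) *ᵥ x = 0 satisfies p.degree ≤ q.degree. Then there exists a unique δ : Fin (d+1) → ℝ such that Σ_{i=0}^{d} δ i • ((M ^ (i : ℕ)) *ᵥ x) = 0 and Σ_{i=0}^{d} δ i = 1. -/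
open Matrix Polynomial Finset

/-- If `1 - M` is invertible and `p` is the minimal polynomial of `M` with respect
to `x`, of degree `d`, then the constrained system
`Σ_{i=0}^{d} δᵢ • (Mⁱ *ᵥ x) = 0`, `Σ δᵢ = 1` has a unique solution. -/
theorem constrained_krylov_system_exists_unique_solution
    {n : Type*} [Fintype n] [DecidableEq n]
    (M : Matrix n n ℝ) (hM : IsUnit (1 - M)) (x : n → ℝ)
    (p : ℝ[X]) (d : ℕ) (hp : p.Monic) (hdeg : p.natDegree = d)
    (hann : (Polynomial.aeval M p) *ᵥ x = 0)
    (hmin : ∀ q : ℝ[X], q.Monic → (Polynomial.aeval M q) *ᵥ x = 0 →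
      p.degree ≤ q.degree) :
    ∃! δ : Fin (d + 1) → ℝ,
      ∑ i : Fin (d + 1), δ i • ((M ^ (i : ℕ)) *ᵥ x) = 0 ∧
      ∑ i : Fin (d + 1), δ i = 1 := by
  have hsmall : ∀ r : ℝ[X], (Polynomial.aeval M r) *ᵥ x = 0 → r.degree < p.degree → r = 0 := by
    intro r hr hlt
    by_contra hne
    have h1 := hmin (r * C r.leadingCoeff⁻¹) (monic_mul_leadingCoeff_inv hne) (by
      rw [mul_comm, map_mul, ← Matrix.mulVec_mulVec, hr, Matrix.mulVec_zero])
    rw [degree_mul_leadingCoeff_inv r hne] at h1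
    exact absurd hlt (not_lt.mpr h1)
  have hp1 : p.eval 1 ≠ 0 := by
    intro h0
    obtain ⟨q, hq⟩ := dvd_iff_isRoot.mpr h0
    have hq0 : q ≠ 0 := by
      rintro rfl
      exact hp.ne_zero (by simpa using hq)
    have hqa : (Polynomial.aeval M q) *ᵥ x = 0 := by
      rw [hq, map_mul, ← Matrix.mulVec_mulVec] at hann
      have h2 : (1 - M) *ᵥ ((Polynomial.aeval M q) *ᵥ x) = 0 := by
        have h3 : (1 - M) = - (Polynomial.aeval M (X - C (1:ℝ))) := by simp
        rw [h3, Matrix.neg_mulVec, hann, neg_zero]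
      obtain ⟨u, hu⟩ := hM
      have h4 := congrArg (fun v => (↑u⁻¹ : Matrix n n ℝ) *ᵥ v) h2
      simpa [← hu, Matrix.mulVec_mulVec] using h4
    refine hq0 (hsmall q hqa ?_)
    rw [hq, degree_mul, degree_X_sub_C, degree_eq_natDegree hq0]
    exact_mod_cast (by omega : q.natDegree < 1 + q.natDegree)
  have hsum : ∀ r : ℝ[X], r.natDegree ≤ d →
      ∑ i : Fin (d + 1), r.coeff i • ((M ^ (i : ℕ)) *ᵥ x) = (Polynomial.aeval M r) *ᵥ x := by
    intro r hr
    rw [aeval_eq_sum_range' (Nat.lt_succ_of_le hr), Matrix.sum_mulVec,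
      ← Fin.sum_univ_eq_sum_range (fun i => (r.coeff i • M ^ i) *ᵥ x)]
    simp [Matrix.smul_mulVec]
  have hev : ∀ r : ℝ[X], r.natDegree ≤ d → ∑ i : Fin (d + 1), r.coeff i = r.eval 1 := by
    intro r hr
    rw [eval_eq_sum_range' (Nat.lt_succ_of_le hr), 
      ← Fin.sum_univ_eq_sum_range (fun i => r.coeff i * 1 ^ i)]
    simp
  have hpdeg : p.degree = d := by rw [degree_eq_natDegree hp.ne_zero, hdeg]
  refine ⟨fun i => (C (p.eval 1)⁻¹ * p).coeff i, ⟨?_, ?_⟩, ?_⟩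
  · rw [hsum _ ((natDegree_C_mul_le _ _).trans hdeg.le), map_mul, ← Matrix.mulVec_mulVec, hann,
      Matrix.mulVec_zero]
  · rw [hev _ ((natDegree_C_mul_le _ _).trans hdeg.le)]
    simp [hp1]
  · rintro δ ⟨h1, h2⟩
    obtain ⟨r, hr, hrδ⟩ : ∃ r : ℝ[X], r.natDegree ≤ d ∧ ∀ i : Fin (d + 1), δ i = r.coeff i := by
      refine ⟨∑ i : Fin (d + 1), C (δ i) * X ^ (i : ℕ), ?_, ?_⟩
      · refine natDegree_sum_le_of_forall_le _ _ fun i _ => ?_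
        exact (natDegree_C_mul_X_pow_le _ _).trans (Nat.le_of_lt_succ i.2)
      · intro i
        simp [finset_sum_coeff, coeff_C_mul, coeff_X_pow, Fin.val_inj]
    simp only [hrδ] at h1 h2
    rw [hsum r hr] at h1
    rw [hev r hr] at h2
    have hs : r - C (r.coeff d) * p = 0 := by
      apply hsmall
      · rw [map_sub, map_mul, Matrix.sub_mulVec, ← Matrix.mulVec_mulVec, hann, h1,
          Matrix.mulVec_zero, sub_zero]
      · rw [hpdeg, degree_lt_iff_coeff_zero]
        intro m hm
        rcases hm.eq_or_lt with rfl | hm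
        · have : p.coeff d = 1 := by rw [← hdeg]; exact hp
          simp [this]
        · rw [coeff_sub, coeff_C_mul, coeff_eq_zero_of_natDegree_lt (hr.trans_lt hm),
            coeff_eq_zero_of_natDegree_lt (hdeg.trans_lt hm)]
          simp
    have hr2 := sub_eq_zero.mp hs
    have hc : r.coeff d = (p.eval 1)⁻¹ := by
      rw [hr2, eval_mul, eval_C] at h2
      exact eq_inv_of_mul_eq_one_left h2
    rw [hc] at hr2
    funext i
    rw [hrδ, hr2]
end
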